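/- Let a, b be positive real numbers with a ≠ b, let k ≥ 0 be an integer, and set δ = π/3. Then ∫₀^∞ t (t−a) (log t)^k / ((t³ + a³)(t² − b t + b²)) dt = (δ^{k+1}/(3(a² + a b + b²))) · [ −P_k(log a / δ) + 3 P_k(log b / δ) + Z_k(log a / δ) ] + (δ^{k+1}(a+b)/(√3 (a³ − b³))) · [ Q_k(log a / δ) − Q_k(log b / δ) ]. -/

import Mathlib

open Finset

/-- Non-recursive part of `Rpoly`. -/
noncomputable def GR (k : ℕ) : Polynomial ℝ :=
  Polynomial.C ((1 : ℝ) / (2 * (k + 1))) *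
    ∑ j ∈ (Finset.range (k + 2)).filter (fun j => Even j),
      Polynomial.C ((-1 : ℝ) ^ (j / 2) * ((k + 1).choose j : ℝ) * ((2 : ℝ) ^ j + 1)) *
        Polynomial.X ^ (k + 1 - j)

noncomputable def GS (k : ℕ) : Polynomial ℝ :=
  Polynomial.C ((1 : ℝ) / (2 * (k + 1))) *
    ∑ j ∈ (Finset.range (k + 2)).filter (fun j => Odd j),
      Polynomial.C ((-1 : ℝ) ^ ((j + 1) / 2) * ((k + 1).choose j : ℝ) * ((2 : ℝ) ^ j - 1)) *
        Polynomial.X ^ (k + 1 - j)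

noncomputable def GP (k : ℕ) : Polynomial ℝ :=
  Polynomial.C ((1 : ℝ) / (2 * (k + 1))) *
    ∑ j ∈ (Finset.range (k + 2)).filter (fun j => Even j),
      Polynomial.C ((-1 : ℝ) ^ (j / 2) * ((k + 1).choose j : ℝ) * ((5 : ℝ) ^ j + 1)) *
        Polynomial.X ^ (k + 1 - j)

noncomputable def GQ (k : ℕ) : Polynomial ℝ :=
  Polynomial.C ((1 : ℝ) / (2 * (k + 1))) *
    ∑ j ∈ (Finset.range (k + 2)).filter (fun j => Odd j),
      Polynomial.C ((-1 : ℝ) ^ ((j - 1) / 2) * ((k + 1).choose j : ℝ) * ((5 : ℝ) ^ j - 1)) *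
        Polynomial.X ^ (k + 1 - j)

noncomputable def GY (k : ℕ) : Polynomial ℝ :=
  Polynomial.C (-((1 : ℝ) / (k + 1))) *
    (Polynomial.X ^ (k + 1) +
      ∑ j ∈ (Finset.range (k + 2)).filter (fun j => Even j),
        Polynomial.C ((-1 : ℝ) ^ (j / 2) * ((k + 1).choose j : ℝ) * ((3 : ℝ) ^ j)) *
          Polynomial.X ^ (k + 1 - j))

noncomputable def GZ (k : ℕ) : Polynomial ℝ :=
  Polynomial.C (-((2 : ℝ) / (k + 1))) *
    ∑ j ∈ (Finset.range (k + 2)).filter (fun j => Even j),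
      Polynomial.C ((-1 : ℝ) ^ (j / 2) * ((k + 1).choose j : ℝ) * ((3 : ℝ) ^ j)) *
        Polynomial.X ^ (k + 1 - j)

/-- The common recursion: `F k = (1/(k+1)) ∑_{3 ≤ j ≤ k+1, j odd}
(−1)^{(j+1)/2} C(k+1,j) m^{j−1} F_{k+1−j} + G k`. -/
noncomputable def recFam (m : ℝ) (G : ℕ → Polynomial ℝ) : ℕ → Polynomial ℝ := fun k =>
  Nat.strongRecOn k fun k ih =>
    Polynomial.C ((1 : ℝ) / (k + 1)) *
      (∑ j ∈ ((Finset.range (k + 2)).filter (fun j => Odd j ∧ 3 ≤ j)).attach,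
        Polynomial.C ((-1 : ℝ) ^ ((j.1 + 1) / 2) * ((k + 1).choose j.1 : ℝ) * m ^ (j.1 - 1)) *
          ih (k + 1 - j.1) (by
            have hj := j.2
            simp only [Finset.mem_filter, Finset.mem_range] at hj
            omega))
    + G k

noncomputable def Rpoly : ℕ → Polynomial ℝ := recFam 3 GR
noncomputable def Spoly : ℕ → Polynomial ℝ := recFam 3 GS
noncomputable def Ppoly : ℕ → Polynomial ℝ := recFam 6 GP
noncomputable def Qpoly : ℕ → Polynomial ℝ := recFam 6 GQ
noncomputable def Ypoly : ℕ → Polynomial ℝ := recFam 3 GY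
noncomputable def Zpoly : ℕ → Polynomial ℝ := recFam 6 GZ

open MeasureTheory

/-- The signed coefficients `(d/dw)^j sin (m w)` at `w = 0`. -/
noncomputable def sinCoeff (m : ℝ) (j : ℕ) : ℝ :=
  if Odd j then (-1) ^ (j / 2) * m ^ j else 0

/-- The signed coefficients `(d/dw)^j cos (m w)` at `w = 0`. -/
noncomputable def cosCoeff (m : ℝ) (j : ℕ) : ℝ :=
  if Even j then (-1) ^ (j / 2) * m ^ j else 0

/-- Binomial convolution of sequences. -/
noncomputable def binomConv (u v : ℕ → ℝ) (n : ℕ) : ℝ :=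
  ∑ i ∈ range (n + 1), (n.choose i : ℝ) * u i * v (n - i)

lemma sinCoeff_mul (c m : ℝ) (j : ℕ) : sinCoeff (c * m) j = c ^ j * sinCoeff m j := by
  unfold sinCoeff; split_ifs <;> ring

lemma cosCoeff_mul (c m : ℝ) (j : ℕ) : cosCoeff (c * m) j = c ^ j * cosCoeff m j := by
  unfold cosCoeff; split_ifs <;> ring

lemma binomConv_scale {u v u' v' : ℕ → ℝ} {c : ℝ} (hu : ∀ j, u' j = c ^ j * u j)
    (hv : ∀ j, v' j = c ^ j * v j) (n : ℕ) :
    binomConv u' v' n = c ^ n * binomConv u v n := by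
  unfold binomConv
  rw [mul_sum]
  refine sum_congr rfl fun i hi => ?_
  have h : c ^ n = c ^ i * c ^ (n - i) := by
    rw [← pow_add, Nat.add_sub_cancel' (Nat.lt_succ_iff.1 (mem_range.1 hi))]
  rw [hu, hv, h]; ring

lemma binomConv_add (u v v' : ℕ → ℝ) (n : ℕ) :
    binomConv u (fun k => v k + v' k) n = binomConv u v n + binomConv u v' n := by
  unfold binomConv
  rw [← sum_add_distrib]
  exact sum_congr rfl fun i _ => by ring

lemma binomConv_const_mul (u v : ℕ → ℝ) (c : ℝ) (n : ℕ) :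
    binomConv u (fun k => c * v k) n = c * binomConv u v n := by
  unfold binomConv
  rw [mul_sum]
  exact sum_congr rfl fun i _ => by ring

/-- Convolution with a sequence having a simple zero at the origin is injective. -/
lemma eq_of_binomConv_eq {u v v' : ℕ → ℝ} (h₀ : u 0 = 0) (h₁ : u 1 ≠ 0)
    (h : ∀ k, binomConv u v (k + 1) = binomConv u v' (k + 1)) (k : ℕ) : v k = v' k := by
  induction k using Nat.strong_induction_on with
  | _ k ih =>
    have hk := h k
    unfold binomConv at hk
    rw [sum_range_succ', sum_range_succ', sum_range_succ' _ (k + 1), sum_range_succ' _ k] at hk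
    have e : ∀ i ∈ range k, ((k + 1).choose (i + 1 + 1) : ℝ) * u (i + 1 + 1) *
        v (k + 1 - (i + 1 + 1)) =
        ((k + 1).choose (i + 1 + 1) : ℝ) * u (i + 1 + 1) * v' (k + 1 - (i + 1 + 1)) := by
      intro i hi
      have := mem_range.1 hi
      rw [ih _ (by omega)]
    rw [sum_congr rfl e] at hk
    simp only [h₀, mul_zero, zero_mul, add_zero, zero_add, Nat.choose_one_right,
      Nat.add_sub_cancel, add_right_inj] at hk
    have hk0 : ((k + 1 : ℕ) : ℝ) ≠ 0 := by positivity
    exact mul_left_cancel₀ (mul_ne_zero hk0 h₁) hk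

lemma recFam_eq (m : ℝ) (G : ℕ → Polynomial ℝ) (k : ℕ) :
    recFam m G k = Polynomial.C ((1 : ℝ) / (k + 1)) *
      (∑ j ∈ (range (k + 2)).filter (fun j => Odd j ∧ 3 ≤ j),
        Polynomial.C ((-1 : ℝ) ^ ((j + 1) / 2) * ((k + 1).choose j : ℝ) * m ^ (j - 1)) *
          recFam m G (k + 1 - j)) + G k := by
  conv_lhs => unfold recFam
  rw [Nat.strongRecOn_eq]
  congr 2
  exact sum_attach ((range (k + 2)).filter (fun j => Odd j ∧ 3 ≤ j)) (fun j =>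
    Polynomial.C ((-1 : ℝ) ^ ((j + 1) / 2) * ((k + 1).choose j : ℝ) * m ^ (j - 1)) *
          recFam m G (k + 1 - j))

lemma binomConv_sinCoeff_recFam (m x : ℝ) (G : ℕ → Polynomial ℝ) (k : ℕ) :
    binomConv (sinCoeff m) (fun k => (recFam m G k).eval x) (k + 1)
      = m * ((k + 1) * (G k).eval x) := by
  have hk : (k + 1 : ℝ) ≠ 0 := by positivity
  have hrec := congrArg (Polynomial.eval x) (recFam_eq m G k)
  simp only [Polynomial.eval_add, Polynomial.eval_mul, Polynomial.eval_C,
    Polynomial.eval_finsetSum] at hrec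
  rw [sum_filter, sum_range_succ', sum_range_succ'] at hrec
  unfold binomConv
  rw [sum_range_succ', sum_range_succ']
  have e : ∑ i ∈ range k, ((k + 1).choose (i + 1 + 1) : ℝ) * sinCoeff m (i + 1 + 1) *
        (recFam m G (k + 1 - (i + 1 + 1))).eval x
      = -m * ∑ i ∈ range k, if Odd (i + 1 + 1) ∧ 3 ≤ i + 1 + 1 then
        (-1 : ℝ) ^ ((i + 1 + 1 + 1) / 2) * ((k + 1).choose (i + 1 + 1) : ℝ) * m ^ (i + 1 + 1 - 1) *
          (recFam m G (k + 1 - (i + 1 + 1))).eval x else 0 := by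
    rw [mul_sum]
    refine sum_congr rfl fun i _ => ?_
    by_cases ho : Odd (i + 1 + 1)
    · obtain ⟨l, hl⟩ := ho
      have h1 : i + 1 + 1 = 2 * l + 1 := hl
      rw [h1, if_pos ⟨⟨l, rfl⟩, by omega⟩, sinCoeff, if_pos ⟨l, rfl⟩,
        show (2 * l + 1) / 2 = l by omega, show (2 * l + 1 + 1) / 2 = l + 1 by omega,
        show 2 * l + 1 - 1 = 2 * l by omega]
      ring
    · rw [if_neg (fun h => ho h.1), sinCoeff, if_neg ho]; ring
  rw [e]
  simp only [sinCoeff, Nat.add_sub_cancel] at hrec ⊢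
  norm_num at hrec ⊢
  rw [hrec]
  field_simp
  ring

lemma mul_eval_GP (k : ℕ) (x : ℝ) : (k + 1) * (GP k).eval x =
    1 / 2 * binomConv (fun j => cosCoeff 5 j + cosCoeff 1 j) (fun j => x ^ j) (k + 1) := by
  have hk : (k + 1 : ℝ) ≠ 0 := by positivity
  simp only [GP, binomConv, Polynomial.eval_mul, Polynomial.eval_C, Polynomial.eval_finsetSum,
    Polynomial.eval_pow, Polynomial.eval_X]
  rw [sum_filter, mul_sum, mul_sum, mul_sum]
  refine sum_congr rfl fun j _ => ?_
  unfold cosCoeff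
  split_ifs
  · field_simp; simp; ring
  · simp

lemma mul_eval_GQ (k : ℕ) (x : ℝ) : (k + 1) * (GQ k).eval x =
    1 / 2 * binomConv (fun j => sinCoeff 5 j - sinCoeff 1 j) (fun j => x ^ j) (k + 1) := by
  have hk : (k + 1 : ℝ) ≠ 0 := by positivity
  simp only [GQ, binomConv, Polynomial.eval_mul, Polynomial.eval_C, Polynomial.eval_finsetSum,
    Polynomial.eval_pow, Polynomial.eval_X]
  rw [sum_filter, mul_sum, mul_sum, mul_sum]
  refine sum_congr rfl fun j _ => ?_
  unfold sinCoeff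
  split_ifs with h
  · obtain ⟨l, rfl⟩ := h
    rw [show (2 * l + 1) / 2 = l by omega, show (2 * l + 1 - 1) / 2 = l by omega]
    field_simp; simp; ring
  · simp

lemma mul_eval_GZ (k : ℕ) (x : ℝ) : (k + 1) * (GZ k).eval x =
    -2 * binomConv (cosCoeff 3) (fun j => x ^ j) (k + 1) := by
  have hk : (k + 1 : ℝ) ≠ 0 := by positivity
  simp only [GZ, binomConv, Polynomial.eval_mul, Polynomial.eval_C, Polynomial.eval_finsetSum,
    Polynomial.eval_pow, Polynomial.eval_X]
  rw [sum_filter, mul_sum, mul_sum, mul_sum]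
  refine sum_congr rfl fun j _ => ?_
  unfold cosCoeff
  split_ifs
  · field_simp
  · simp

/-- `f` is analytic at `0` with the (real) sequence `u` as its derivatives there. -/
def HasDerivsAtZero (f : ℂ → ℂ) (u : ℕ → ℝ) : Prop :=
  AnalyticAt ℂ f 0 ∧ ∀ n, iteratedDeriv n f 0 = u n

namespace HasDerivsAtZero

variable {f g : ℂ → ℂ} {u v : ℕ → ℝ}

lemma add (hf : HasDerivsAtZero f u) (hg : HasDerivsAtZero g v) :
    HasDerivsAtZero (fun w => f w + g w) (fun n => u n + v n) := by
  refine ⟨hf.1.fun_add hg.1, fun n => ?_⟩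
  rw [iteratedDeriv_fun_add hf.1.contDiffAt hg.1.contDiffAt, hf.2, hg.2]
  push_cast; rfl

lemma const_mul (c : ℝ) (hf : HasDerivsAtZero f u) :
    HasDerivsAtZero (fun w => c * f w) (fun n => c * u n) := by
  refine ⟨analyticAt_const.fun_mul hf.1, fun n => ?_⟩
  rw [iteratedDeriv_const_mul_field, hf.2]
  push_cast; rfl

lemma sub (hf : HasDerivsAtZero f u) (hg : HasDerivsAtZero g v) :
    HasDerivsAtZero (fun w => f w - g w) (fun n => u n - v n) := by
  convert hf.add (hg.const_mul (-1)) using 2 <;> push_cast <;> ring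

lemma mul (hf : HasDerivsAtZero f u) (hg : HasDerivsAtZero g v) :
    HasDerivsAtZero (fun w => f w * g w) (binomConv u v) := by
  refine ⟨hf.1.fun_mul hg.1, fun n => ?_⟩
  rw [iteratedDeriv_fun_mul hf.1.contDiffAt hg.1.contDiffAt, binomConv]
  push_cast
  exact sum_congr rfl fun i _ => by rw [hf.2, hg.2]

lemma unique (hf : HasDerivsAtZero f u) (hg : HasDerivsAtZero g v) (h : f =ᶠ[nhds 0] g) (n : ℕ) :
    u n = v n := by
  have := h.iteratedDeriv_eq n
  rw [hf.2, hg.2] at this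
  exact_mod_cast this

lemma exp (L : ℝ) : HasDerivsAtZero (fun w => Complex.exp (L * w)) (fun n => L ^ n) := by
  refine ⟨by fun_prop, fun n => ?_⟩
  rw [iteratedDeriv_cexp_const_mul]
  simp

lemma sin (m : ℝ) : HasDerivsAtZero (fun w => Complex.sin (m * w)) (sinCoeff m) := by
  refine ⟨by fun_prop, fun n => ?_⟩
  rw [iteratedDeriv_comp_const_mul Complex.contDiff_sin]
  rcases Nat.even_or_odd' n with ⟨l, rfl | rfl⟩
  · rw [sinCoeff, if_neg (by simp)]
    simp
  · rw [Complex.iteratedDeriv_odd_sin, sinCoeff, if_pos ⟨l, rfl⟩,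
      show (2 * l + 1) / 2 = l by omega]
    simp [mul_comm]

lemma cos (m : ℝ) : HasDerivsAtZero (fun w => Complex.cos (m * w)) (cosCoeff m) := by
  refine ⟨by fun_prop, fun n => ?_⟩
  rw [iteratedDeriv_comp_const_mul Complex.contDiff_cos]
  rcases Nat.even_or_odd' n with ⟨l, rfl | rfl⟩
  · rw [Complex.iteratedDeriv_even_cos, cosCoeff, if_pos (by simp),
      Nat.mul_div_cancel_left _ two_pos]
    simp [mul_comm]
  · rw [Complex.iteratedDeriv_odd_cos, cosCoeff, if_neg (by simp)]
    simp

end HasDerivsAtZero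

lemma mellin_inv_one_add {s : ℂ} (h₀ : 0 < s.re) (h₁ : s.re < 1) :
    mellin (fun x : ℝ => (((1 + x)⁻¹ : ℝ) : ℂ)) s = Real.pi / Complex.sin (Real.pi * s) := by
  have hB : Complex.betaIntegral s (1 - s) = Real.pi / Complex.sin (Real.pi * s) := by
    have h := Complex.Gamma_mul_Gamma_eq_betaIntegral h₀ (t := 1 - s) (by simpa using h₁)
    rw [Complex.Gamma_mul_Gamma_one_sub] at h
    simpa using h.symm
  have himg : (fun t : ℝ => t / (1 + t)) '' Set.Ioi 0 = Set.Ioo 0 1 := by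
    ext y
    constructor
    · rintro ⟨t, ht, rfl⟩
      have ht : 0 < t := ht
      exact ⟨by positivity, by rw [div_lt_one (by positivity)]; linarith⟩
    · rintro ⟨h0, h1⟩
      have h1' : 0 < 1 - y := by linarith
      refine ⟨y / (1 - y), div_pos h0 h1', ?_⟩
      field_simp
      ring
  have hder : ∀ t ∈ Set.Ioi (0 : ℝ),
      HasDerivWithinAt (fun t : ℝ => t / (1 + t)) (((1 + t) ^ 2)⁻¹) (Set.Ioi 0) t := by
    intro t ht
    have ht : 0 < t := ht
    have h := (hasDerivAt_id t).div ((hasDerivAt_id t).const_add 1) (by simp; positivity)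
    refine (h.congr_deriv ?_).hasDerivWithinAt
    simp
  have hinj : Set.InjOn (fun t : ℝ => t / (1 + t)) (Set.Ioi 0) := by
    intro x hx y hy hxy
    have hx : 0 < x := hx
    have hy : 0 < y := hy
    have h := (div_eq_div_iff (by positivity) (by positivity)).1 hxy
    linarith
  rw [← hB, Complex.betaIntegral, intervalIntegral.integral_of_le zero_le_one,
    integral_Ioc_eq_integral_Ioo, ← himg,
    integral_image_eq_integral_abs_deriv_smul measurableSet_Ioi hder hinj, mellin]
  refine setIntegral_congr_fun measurableSet_Ioi fun t ht => ?_
  have ht : 0 < t := ht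
  have h1t : (0 : ℝ) < 1 + t := by positivity
  have hc : ((1 + t : ℝ) : ℂ) ≠ 0 := by exact_mod_cast h1t.ne'
  have hq : (1 : ℂ) - ((t / (1 + t) : ℝ) : ℂ) = (((1 + t)⁻¹ : ℝ) : ℂ) := by
    rw [← Complex.ofReal_one, ← Complex.ofReal_sub]
    congr 1
    field_simp
    ring
  have e1 : ((t / (1 + t) : ℝ) : ℂ) ^ (s - 1) =
      (t : ℂ) ^ (s - 1) * (((1 + t)⁻¹ : ℝ) : ℂ) ^ (s - 1) := by
    rw [div_eq_mul_inv, Complex.ofReal_mul,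
      Complex.mul_cpow_ofReal_nonneg ht.le (inv_nonneg.2 h1t.le)]
  have e2 : (((1 + t)⁻¹ : ℝ) : ℂ) ^ (s - 1) * (((1 + t)⁻¹ : ℝ) : ℂ) ^ (1 - s - 1)
      = ((1 + t : ℝ) : ℂ) := by
    rw [← Complex.cpow_add _ _ (by exact_mod_cast (inv_pos.2 h1t).ne'),
      show s - 1 + (1 - s - 1) = -1 by ring, Complex.cpow_neg_one]
    push_cast
    rw [inv_inv]
  simp only [smul_eq_mul]
  rw [hq, e1, mul_assoc, e2, abs_of_pos (by positivity), Complex.real_smul]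
  push_cast at hc ⊢
  field_simp

lemma mellinConvergent_inv_one_add {s : ℂ} (h₀ : 0 < s.re) (h₁ : s.re < 1) :
    MellinConvergent (fun x : ℝ => (((1 + x)⁻¹ : ℝ) : ℂ)) s := by
  refine mellinConvergent_of_isBigO_rpow (a := 1) (b := 0) ?_ ?_ h₁ ?_ h₀
  · refine ContinuousOn.locallyIntegrableOn ?_ measurableSet_Ioi
    refine Complex.continuous_ofReal.comp_continuousOn ?_
    refine (by fun_prop : ContinuousOn (fun x : ℝ => 1 + x) _).inv₀ fun x hx => ?_
    have : 0 < x := hx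
    positivity
  · refine Asymptotics.IsBigO.of_bound 1 ?_
    filter_upwards [Filter.eventually_gt_atTop 0] with x hx
    rw [Complex.norm_real, Real.rpow_neg_one, one_mul]
    rw [Real.norm_of_nonneg (by positivity), Real.norm_of_nonneg (by positivity)]
    gcongr
    linarith
  · refine Asymptotics.IsBigO.of_bound 1 ?_
    filter_upwards [self_mem_nhdsWithin] with x hx
    have hx : 0 < x := hx
    rw [Complex.norm_real, Real.norm_of_nonneg (by positivity)]
    simp only [neg_zero, Real.rpow_zero, norm_one, mul_one]
    exact inv_le_one_of_one_le₀ (by linarith)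

lemma inv_cube_add_cube_eq {c : ℝ} (hc : 0 < c) :
    (fun t : ℝ => (((t ^ 3 + c ^ 3)⁻¹ : ℝ) : ℂ)) =
      fun t => ((c : ℂ) ^ 3)⁻¹ • (((1 + (c⁻¹ * t) ^ (3 : ℝ))⁻¹ : ℝ) : ℂ) := by
  funext t
  rw [show (3 : ℝ) = ((3 : ℕ) : ℝ) by norm_num, Real.rpow_natCast, smul_eq_mul]
  norm_cast
  rw [← mul_inv]
  congr 2
  field_simp
  ring

lemma hasMellin_inv_cube_add_cube {c : ℝ} (hc : 0 < c) {s : ℂ} (h₀ : 0 < s.re) (h₁ : s.re < 3) :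
    HasMellin (fun t : ℝ => (((t ^ 3 + c ^ 3)⁻¹ : ℝ) : ℂ)) s
      (Real.pi / 3 * ((c : ℂ) ^ s / (c : ℂ) ^ 3) / Complex.sin (Real.pi / 3 * s)) := by
  have hre : (s / ((3 : ℝ) : ℂ)).re = s.re / 3 := Complex.div_ofReal_re s 3
  have k₀ : 0 < (s / ((3 : ℝ) : ℂ)).re := by rw [hre]; positivity
  have k₁ : (s / ((3 : ℝ) : ℂ)).re < 1 := by rw [hre]; linarith
  rw [inv_cube_add_cube_eq hc]
  constructor
  · exact (((MellinConvergent.comp_mul_left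
      (f := fun u : ℝ => (((1 + u ^ (3 : ℝ))⁻¹ : ℝ) : ℂ)) (inv_pos.2 hc)).2
      ((MellinConvergent.comp_rpow (f := fun u : ℝ => (((1 + u)⁻¹ : ℝ) : ℂ)) three_ne_zero).2
        (mellinConvergent_inv_one_add k₀ k₁)))).const_smul _
  · rw [mellin_const_smul, mellin_comp_mul_left (fun u : ℝ => (((1 + u ^ (3 : ℝ))⁻¹ : ℝ) : ℂ)) _
      (inv_pos.2 hc), mellin_comp_rpow (fun u : ℝ => (((1 + u)⁻¹ : ℝ) : ℂ)),
      mellin_inv_one_add k₀ k₁, Complex.ofReal_inv, Complex.inv_cpow, Complex.cpow_neg, inv_inv,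
      abs_of_pos (by norm_num : (0 : ℝ) < 3), Complex.real_smul]
    · push_cast
      rw [show (Real.pi : ℂ) * (s / 3) = Real.pi / 3 * s by ring]
      simp only [smul_eq_mul]
      ring
    · rw [Complex.arg_ofReal_of_nonneg hc.le]
      exact Real.pi_pos.ne

lemma hasMellin_pow_mul_inv_cube_add_cube {c : ℝ} (hc : 0 < c) (n : ℕ) {s : ℂ}
    (h₀ : 0 < s.re + n) (h₁ : s.re + n < 3) :
    HasMellin (fun t : ℝ => (t : ℂ) ^ n * (((t ^ 3 + c ^ 3)⁻¹ : ℝ) : ℂ)) s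
      (Real.pi / 3 * ((c : ℂ) ^ (s + n) / (c : ℂ) ^ 3) / Complex.sin (Real.pi / 3 * (s + n))) := by
  have h := hasMellin_inv_cube_add_cube hc (s := s + n) (by simpa) (by simpa)
  have e : (fun t : ℝ => (t : ℂ) ^ n * (((t ^ 3 + c ^ 3)⁻¹ : ℝ) : ℂ)) =
      fun t : ℝ => (t : ℂ) ^ (n : ℂ) • (((t ^ 3 + c ^ 3)⁻¹ : ℝ) : ℂ) := by
    funext t
    rw [Complex.cpow_natCast, smul_eq_mul]
  rw [e]
  exact ⟨MellinConvergent.cpow_smul.2 h.1, (mellin_cpow_smul _ _ _).trans h.2⟩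

/-- Derivatives of the Mellin transform are Mellin transforms of logarithmic weights. -/
lemma iteratedDeriv_mellin {f : ℝ → ℂ} {a b : ℝ} (hfc : LocallyIntegrableOn f (Set.Ioi 0))
    (hf_top : f =O[Filter.atTop] (· ^ (-a))) (hf_bot : f =O[nhdsWithin 0 (Set.Ioi 0)] (· ^ (-b)))
    (k : ℕ) : Set.EqOn (iteratedDeriv k (mellin f)) (mellin fun t => Real.log t ^ k • f t)
      {s | b < s.re ∧ s.re < a} := by
  induction k generalizing f a b with
  | zero => intro s _; simp
  | succ k ih =>
    rintro s ⟨hb, ha⟩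
    obtain ⟨a', ha₁, ha₂⟩ := exists_between ha
    obtain ⟨b', hb₁, hb₂⟩ := exists_between hb
    have hfc' : LocallyIntegrableOn (fun t => Real.log t • f t) (Set.Ioi 0) :=
      hfc.continuousOn_smul isOpen_Ioi.isLocallyClosed
        (Real.continuousOn_log.mono fun t ht => (ne_of_gt ht : t ≠ 0))
    have hU : IsOpen {s : ℂ | b' < s.re ∧ s.re < a'} :=
      (isOpen_lt continuous_const Complex.continuous_re).inter
        (isOpen_lt Complex.continuous_re continuous_const)
    have hd : Set.EqOn (deriv (mellin f)) (mellin fun t => Real.log t • f t)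
        {s : ℂ | b' < s.re ∧ s.re < a'} := fun z hz =>
      (mellin_hasDerivAt_of_isBigO_rpow hfc hf_top (hz.2.trans ha₂) hf_bot
        (hb₁.trans hz.1)).2.deriv
    rw [iteratedDeriv_succ', hd.iteratedDeriv_of_isOpen hU k ⟨hb₂, ha₁⟩,
      ih hfc' (isBigO_rpow_top_log_smul ha₂ hf_top) (isBigO_rpow_zero_log_smul hb₁ hf_bot)
        ⟨hb₂, ha₁⟩]
    simp only [pow_succ, mul_smul]

lemma sq_sub_mul_add_sq_pos {b : ℝ} (hb : 0 < b) (t : ℝ) : 0 < t ^ 2 - b * t + b ^ 2 := by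
  nlinarith [sq_nonneg (t - b / 2), sq_pos_of_pos hb]

lemma continuousOn_integrand {a b : ℝ} (ha : 0 < a) (hb : 0 < b) :
    ContinuousOn (fun t : ℝ =>
      ((t * (t - a) / ((t ^ 3 + a ^ 3) * (t ^ 2 - b * t + b ^ 2)) : ℝ) : ℂ))
      (Set.Ioi 0) := by
  refine Complex.continuous_ofReal.comp_continuousOn ?_
  refine ContinuousOn.div (by fun_prop) (by fun_prop) fun t ht => ?_
  have ht : 0 < t := ht
  have := sq_sub_mul_add_sq_pos hb t
  positivity

lemma integrand_isBigO_atTop {a b : ℝ} (ha : 0 < a) (hb : 0 < b) :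
    (fun t : ℝ => ((t * (t - a) / ((t ^ 3 + a ^ 3) * (t ^ 2 - b * t + b ^ 2)) : ℝ) : ℂ))
      =O[Filter.atTop] (· ^ (-3 : ℝ)) := by
  refine Asymptotics.IsBigO.of_bound (4 / 3) ?_
  filter_upwards [Filter.eventually_gt_atTop a] with t ht
  have ht0 : 0 < t := ha.trans ht
  have hq : 3 / 4 * t ^ 2 ≤ t ^ 2 - b * t + b ^ 2 := by nlinarith [sq_nonneg (t / 2 - b)]
  have hq0 := sq_sub_mul_add_sq_pos hb t
  have hta : 0 < t - a := sub_pos.2 ht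
  rw [Complex.norm_real, Real.norm_of_nonneg (by positivity), Real.norm_of_nonneg (by positivity),
    Real.rpow_neg ht0.le, show (3 : ℝ) = ((3 : ℕ) : ℝ) by norm_num, Real.rpow_natCast]
  calc t * (t - a) / ((t ^ 3 + a ^ 3) * (t ^ 2 - b * t + b ^ 2))
      ≤ t * t / (t ^ 3 * (3 / 4 * t ^ 2)) := by
        gcongr
        · linarith
        · have : 0 < a ^ 3 := by positivity
          linarith
    _ = _ := by
        push_cast
        field_simp

lemma integrand_isBigO_zero {a b : ℝ} (ha : 0 < a) (hb : 0 < b) :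
    (fun t : ℝ => ((t * (t - a) / ((t ^ 3 + a ^ 3) * (t ^ 2 - b * t + b ^ 2)) : ℝ) : ℂ))
      =O[nhdsWithin 0 (Set.Ioi 0)] (· ^ (-0 : ℝ)) := by
  have hc : ContinuousAt (fun t : ℝ =>
      ((t * (t - a) / ((t ^ 3 + a ^ 3) * (t ^ 2 - b * t + b ^ 2)) : ℝ) : ℂ)) 0 := by
    refine Complex.continuous_ofReal.continuousAt.comp ?_
    refine ContinuousAt.div (by fun_prop) (by fun_prop) ?_
    have := sq_sub_mul_add_sq_pos hb 0
    positivity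
  simpa using (hc.tendsto.mono_left nhdsWithin_le_nhds).isBigO_one ℝ

lemma cpow_add_natCast_eq {c : ℝ} (hc : 0 < c) (w : ℂ) (n : ℕ) :
    (c : ℂ) ^ (w + n) = Complex.exp (Real.log c * w) * (c : ℂ) ^ n := by
  have hc0 : (c : ℂ) ≠ 0 := by exact_mod_cast hc.ne'
  rw [Complex.cpow_add _ _ hc0, Complex.cpow_natCast, Complex.cpow_def_of_ne_zero hc0,
    Complex.ofReal_log hc.le]

lemma hasMellin_quadratic_mul_inv_cube_add_cube {c : ℝ} (hc : 0 < c) (p q : ℝ) {w : ℂ}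
    (h₀ : -1 < w.re) (h₁ : w.re < 0) :
    HasMellin (fun t : ℝ => (c : ℂ) ^ 3 * ((t : ℂ) ^ 0 * (((t ^ 3 + c ^ 3)⁻¹ : ℝ) : ℂ))
        + q * ((t : ℂ) ^ 1 * (((t ^ 3 + c ^ 3)⁻¹ : ℝ) : ℂ))
        + p * ((t : ℂ) ^ 2 * (((t ^ 3 + c ^ 3)⁻¹ : ℝ) : ℂ))) (w + 1)
      (Real.pi / 3 * Complex.exp (Real.log c * w) *
        (c / Complex.sin (Real.pi / 3 * w + Real.pi / 3)
          + q / c / Complex.sin (Real.pi / 3 * w + 2 * (Real.pi / 3))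
          - p / Complex.sin (Real.pi / 3 * w))) := by
  have hc0 : (c : ℂ) ≠ 0 := by exact_mod_cast hc.ne'
  have hre : (w + 1).re = w.re + 1 := by simp
  have m (n : ℕ) (hn : n ≤ 2) := by
    have hn' : (n : ℝ) ≤ 2 := by exact_mod_cast hn
    exact hasMellin_pow_mul_inv_cube_add_cube hc n (s := w + 1)
      (by rw [hre]; have := n.cast_nonneg (α := ℝ); linarith) (by rw [hre]; linarith)
  have n₀ := hasMellin_const_smul (m 0 (by norm_num)).1 ((c : ℂ) ^ 3)
  have n₁ := hasMellin_const_smul (m 1 (by norm_num)).1 (q : ℂ)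
  have n₂ := hasMellin_const_smul (m 2 (by norm_num)).1 (p : ℂ)
  have key := hasMellin_add (hasMellin_add n₀.1 n₁.1).1 n₂.1
  refine ⟨key.1, key.2.trans ?_⟩
  rw [(hasMellin_add n₀.1 n₁.1).2, n₀.2, n₁.2, n₂.2, (m 0 (by norm_num)).2,
    (m 1 (by norm_num)).2, (m 2 (by norm_num)).2]
  have e (n : ℕ) : w + 1 + (n : ℂ) = w + ((n + 1 : ℕ) : ℂ) := by push_cast; ring
  rw [e, e, e, cpow_add_natCast_eq hc, cpow_add_natCast_eq hc, cpow_add_natCast_eq hc]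
  have a₀ : (Real.pi : ℂ) / 3 * (w + ((0 + 1 : ℕ) : ℂ)) = Real.pi / 3 * w + Real.pi / 3 := by
    push_cast; ring
  have a₁ : (Real.pi : ℂ) / 3 * (w + ((1 + 1 : ℕ) : ℂ)) = Real.pi / 3 * w + 2 * (Real.pi / 3) := by
    push_cast; ring
  have a₂ : (Real.pi : ℂ) / 3 * (w + ((2 + 1 : ℕ) : ℂ)) = Real.pi / 3 * w + Real.pi := by
    push_cast; ring
  rw [a₀, a₁, a₂, Complex.sin_add_pi, div_neg]
  simp only [smul_eq_mul]
  field_simp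
  ring

lemma integrand_eq_partial_fractions {a b : ℝ} (ha : 0 < a) (hb : 0 < b) (hab : a ≠ b) {t : ℝ}
    (ht : 0 < t) :
    t * (t - a) / ((t ^ 3 + a ^ 3) * (t ^ 2 - b * t + b ^ 2)) =
      (a ^ 3 - b ^ 3)⁻¹ *
        ((a ^ 3 + a * b * t + (a - b) * t ^ 2) * (t ^ 3 + a ^ 3)⁻¹
          - (b ^ 3 + a * b * t + (a - b) * t ^ 2) * (t ^ 3 + b ^ 3)⁻¹) := by
  have h₁ : t ^ 3 + b ^ 3 = (t + b) * (t ^ 2 - b * t + b ^ 2) := by ring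
  have h₂ : t + b ≠ 0 := by positivity
  have h₃ : t ^ 3 + a ^ 3 ≠ 0 := by positivity
  have h₄ : t ^ 3 + b ^ 3 ≠ 0 := by positivity
  have h₅ : a ^ 3 - b ^ 3 ≠ 0 := sub_ne_zero.2 fun h =>
    hab ((pow_left_inj₀ ha.le hb.le three_ne_zero).1 h)
  have h₆ : t * (t - a) / ((t ^ 3 + a ^ 3) * (t ^ 2 - b * t + b ^ 2)) =
      t * (t - a) * (t + b) / ((t ^ 3 + a ^ 3) * (t ^ 3 + b ^ 3)) := by
    rw [h₁, ← mul_div_mul_right _ _ h₂]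
    congr 1
    ring
  rw [h₆]
  field_simp
  ring

lemma mellin_integrand {a b : ℝ} (ha : 0 < a) (hb : 0 < b) (hab : a ≠ b) {w : ℂ}
    (h₀ : -1 < w.re) (h₁ : w.re < 0) :
    mellin (fun t : ℝ =>
        ((t * (t - a) / ((t ^ 3 + a ^ 3) * (t ^ 2 - b * t + b ^ 2)) : ℝ) : ℂ)) (w + 1) =
      ((a : ℂ) ^ 3 - b ^ 3)⁻¹ * (Real.pi / 3) *
        (Complex.exp (Real.log a * w) *
          (a / Complex.sin (Real.pi / 3 * w + Real.pi / 3)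
            + b / Complex.sin (Real.pi / 3 * w + 2 * (Real.pi / 3))
            - (a - b) / Complex.sin (Real.pi / 3 * w))
        - Complex.exp (Real.log b * w) *
          (b / Complex.sin (Real.pi / 3 * w + Real.pi / 3)
            + a / Complex.sin (Real.pi / 3 * w + 2 * (Real.pi / 3))
            - (a - b) / Complex.sin (Real.pi / 3 * w))) := by
  have ha0 : (a : ℂ) ≠ 0 := by exact_mod_cast ha.ne'
  have hb0 : (b : ℂ) ≠ 0 := by exact_mod_cast hb.ne'
  have ma := hasMellin_quadratic_mul_inv_cube_add_cube ha (a - b) (a * b) h₀ h₁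
  have mb := hasMellin_quadratic_mul_inv_cube_add_cube hb (a - b) (a * b) h₀ h₁
  have key := hasMellin_const_smul (hasMellin_sub ma.1 mb.1).1 (((a : ℂ) ^ 3 - b ^ 3)⁻¹)
  rw [(hasMellin_sub ma.1 mb.1).2, ma.2, mb.2] at key
  refine (setIntegral_congr_fun measurableSet_Ioi fun t ht => ?_).trans (key.2.trans ?_)
  · dsimp only
    rw [integrand_eq_partial_fractions ha hb hab ht]
    simp only [smul_eq_mul]
    push_cast
    ring
  · push_cast
    rw [mul_div_cancel_left₀ _ ha0, mul_div_cancel_right₀ _ hb0]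
    simp only [smul_eq_mul]
    ring

lemma sin_add_pi_div_three (z : ℂ) :
    Complex.sin (z + Real.pi / 3) = (Complex.sin z + (Real.sqrt 3 : ℝ) * Complex.cos z) / 2 := by
  have hs : Complex.sin (Real.pi / 3) = (Real.sqrt 3 : ℝ) / 2 := by
    have := congrArg Complex.ofReal Real.sin_pi_div_three
    push_cast at this
    exact this
  have hc : Complex.cos (Real.pi / 3) = 1 / 2 := by
    have := congrArg Complex.ofReal Real.cos_pi_div_three
    push_cast at this
    exact this
  rw [Complex.sin_add, hs, hc]
  ring

lemma sin_add_two_mul_pi_div_three (z : ℂ) :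
    Complex.sin (z + 2 * (Real.pi / 3)) =
      ((Real.sqrt 3 : ℝ) * Complex.cos z - Complex.sin z) / 2 := by
  have h := sin_add_pi_div_three (-z)
  rw [Complex.sin_neg, Complex.cos_neg] at h
  rw [show z + 2 * ((Real.pi : ℂ) / 3) = Real.pi - (-z + Real.pi / 3) by ring,
    Complex.sin_pi_sub, h]
  ring

lemma ofReal_sqrt_three_sq : ((Real.sqrt 3 : ℝ) : ℂ) ^ 2 = 3 := by
  exact_mod_cast Real.sq_sqrt (zero_le_three (α := ℝ))

lemma sin_six_mul (z : ℂ) : Complex.sin (6 * z) = 8 * Complex.cos (3 * z) *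
    (Complex.sin z * Complex.sin (z + Real.pi / 3) * Complex.sin (z + 2 * (Real.pi / 3))) := by
  rw [show 6 * z = 2 * (3 * z) by ring, Complex.sin_two_mul, Complex.sin_three_mul,
    sin_add_pi_div_three, sin_add_two_mul_pi_div_three]
  linear_combination (-2 * Complex.cos (3 * z) * Complex.sin z * Complex.cos z ^ 2)
    * ofReal_sqrt_three_sq - 6 * Complex.cos (3 * z) * Complex.sin z * Complex.sin_sq_add_cos_sq z

lemma sin_six_mul_mul_eq {z : ℂ} (h₀ : Complex.sin z ≠ 0) (h₁ : Complex.sin (z + Real.pi / 3) ≠ 0)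
    (h₂ : Complex.sin (z + 2 * (Real.pi / 3)) ≠ 0) (a b x y : ℂ) :
    Complex.sin (6 * z) *
      (x * (a / Complex.sin (z + Real.pi / 3) + b / Complex.sin (z + 2 * (Real.pi / 3))
          - (a - b) / Complex.sin z)
        - y * (b / Complex.sin (z + Real.pi / 3) + a / Complex.sin (z + 2 * (Real.pi / 3))
          - (a - b) / Complex.sin z)) =
      (a - b) * (3 * ((Complex.cos (5 * z) + Complex.cos z) * y)
          - (Complex.cos (5 * z) + Complex.cos z) * x - 4 * (Complex.cos (3 * z) * x))
        + (Real.sqrt 3 : ℝ) * (a + b) * ((Complex.sin (5 * z) - Complex.sin z) * x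
          - (Complex.sin (5 * z) - Complex.sin z) * y) := by
  have hc : Complex.cos (5 * z) + Complex.cos z =
      2 * Complex.cos (3 * z) * (Complex.cos z ^ 2 - Complex.sin z ^ 2) := by
    have h : Complex.cos z = Complex.cos (3 * z - 2 * z) := by congr 1; ring
    rw [Complex.cos_sub] at h
    rw [show 5 * z = 3 * z + 2 * z by ring, Complex.cos_add]
    linear_combination h + 2 * Complex.cos (3 * z) * Complex.cos_two_mul' z
  have hs : Complex.sin (5 * z) - Complex.sin z =
      4 * Complex.cos (3 * z) * (Complex.sin z * Complex.cos z) := by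
    have h : Complex.sin z = Complex.sin (3 * z - 2 * z) := by congr 1; ring
    rw [Complex.sin_sub] at h
    rw [show 5 * z = 3 * z + 2 * z by ring, Complex.sin_add]
    linear_combination 2 * Complex.cos (3 * z) * Complex.sin_two_mul z - h
  rw [sin_six_mul, hc, hs]
  have e : ∀ S A B : ℂ, S ≠ 0 → A ≠ 0 → B ≠ 0 →
      8 * Complex.cos (3 * z) * (S * A * B) *
        (x * (a / A + b / B - (a - b) / S) - y * (b / A + a / B - (a - b) / S)) =
      8 * Complex.cos (3 * z) * (x * (a * (S * B) + b * (S * A) - (a - b) * (A * B))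
        - y * (b * (S * B) + a * (S * A) - (a - b) * (A * B))) := by
    intro S A B hS hA hB
    field_simp
  rw [e _ _ _ h₀ h₁ h₂, sin_add_pi_div_three, sin_add_two_mul_pi_div_three]
  linear_combination
    (-2 * Complex.cos (3 * z) * (a - b) * Complex.cos z ^ 2 * (x - y)) * ofReal_sqrt_three_sq
      + (-4 * Complex.cos (3 * z) * (a - b) * x) * Complex.sin_sq_add_cos_sq z

lemma sin_pi_mul_ne_zero_of_re_ne_zero {u : ℂ} (h₀ : -1 < u.re) (h₁ : u.re < 1) (h : u.re ≠ 0) :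
    Complex.sin (Real.pi * u) ≠ 0 := by
  rw [Complex.sin_ne_zero_iff]
  intro n hn
  have hpi : (Real.pi : ℂ) ≠ 0 := by exact_mod_cast Real.pi_ne_zero
  have hu : u = n := mul_left_cancel₀ hpi (hn.trans (mul_comm _ _))
  rw [hu, Complex.intCast_re] at h₀ h₁ h
  have l₀ : -1 < n := by exact_mod_cast h₀
  have l₁ : n < 1 := by exact_mod_cast h₁
  exact h (by exact_mod_cast (by omega : n = 0))

/-- Numerator of the Mellin transform of the integrand over the common denominator `sin (2πw)`. -/
noncomputable def mellinNumerator (a b : ℝ) (w : ℂ) : ℂ :=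
  (Real.pi / 3 * (1 / (3 * (a ^ 2 + a * b + b ^ 2))) : ℝ) *
      ((9 : ℝ) * ((Complex.cos ((Real.pi / 3 * 5 : ℝ) * w) +
          Complex.cos ((Real.pi / 3 * 1 : ℝ) * w)) *
          Complex.exp (Real.log b * w))
        - (3 : ℝ) * ((Complex.cos ((Real.pi / 3 * 5 : ℝ) * w) +
          Complex.cos ((Real.pi / 3 * 1 : ℝ) * w)) * Complex.exp (Real.log a * w))
        - (12 : ℝ) * (Complex.cos ((Real.pi / 3 * 3 : ℝ) * w) * Complex.exp (Real.log a * w)))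
    + (Real.pi / 3 * (3 * ((a + b) / (Real.sqrt 3 * (a ^ 3 - b ^ 3)))) : ℝ) *
      ((Complex.sin ((Real.pi / 3 * 5 : ℝ) * w) - Complex.sin ((Real.pi / 3 * 1 : ℝ) * w)) *
          Complex.exp (Real.log a * w)
        - (Complex.sin ((Real.pi / 3 * 5 : ℝ) * w) - Complex.sin ((Real.pi / 3 * 1 : ℝ) * w)) *
          Complex.exp (Real.log b * w))

lemma sin_mul_mellin_integrand_of_re_neg {a b : ℝ} (ha : 0 < a) (hb : 0 < b) (hab : a ≠ b) {w : ℂ}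
    (h₀ : -1 < w.re) (h₁ : w.re < 0) :
    Complex.sin ((Real.pi / 3 * 6 : ℝ) * w) * mellin (fun t : ℝ =>
        ((t * (t - a) / ((t ^ 3 + a ^ 3) * (t ^ 2 - b * t + b ^ 2)) : ℝ) : ℂ)) (w + 1) =
      mellinNumerator a b w := by
  have hre : (w / 3).re = w.re / 3 := Complex.div_ofReal_re w 3
  have s₀ : Complex.sin (Real.pi / 3 * w) ≠ 0 := by
    rw [show (Real.pi / 3 * w : ℂ) = Real.pi * (w / 3) by ring]
    apply sin_pi_mul_ne_zero_of_re_ne_zero <;> rw [hre]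
    · linarith
    · linarith
    · exact (by linarith : w.re / 3 < 0).ne
  have s₁ : Complex.sin (Real.pi / 3 * w + Real.pi / 3) ≠ 0 := by
    have hre' : (w / 3 + ((1 / 3 : ℝ) : ℂ)).re = w.re / 3 + 1 / 3 := by
      rw [Complex.add_re, hre, Complex.ofReal_re]
    rw [show (Real.pi / 3 * w + Real.pi / 3 : ℂ) = Real.pi * (w / 3 + ((1 / 3 : ℝ) : ℂ)) by
      push_cast; ring]
    apply sin_pi_mul_ne_zero_of_re_ne_zero <;> rw [hre']
    · linarith
    · linarith
    · exact (by linarith : 0 < w.re / 3 + 1 / 3).ne'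
  have s₂ : Complex.sin (Real.pi / 3 * w + 2 * (Real.pi / 3)) ≠ 0 := by
    have hre' : (w / 3 + ((2 / 3 : ℝ) : ℂ)).re = w.re / 3 + 2 / 3 := by
      rw [Complex.add_re, hre, Complex.ofReal_re]
    rw [show (Real.pi / 3 * w + 2 * (Real.pi / 3) : ℂ) = Real.pi * (w / 3 + ((2 / 3 : ℝ) : ℂ)) by
      push_cast; ring]
    apply sin_pi_mul_ne_zero_of_re_ne_zero <;> rw [hre']
    · linarith
    · linarith
    · exact (by linarith : 0 < w.re / 3 + 2 / 3).ne'
  have key := sin_six_mul_mul_eq s₀ s₁ s₂ a b (Complex.exp (Real.log a * w))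
    (Complex.exp (Real.log b * w))
  rw [mellin_integrand ha hb hab h₀ h₁, mellinNumerator]
  push_cast
  have e₁ : (Real.pi / 3 * 1 * w : ℂ) = Real.pi / 3 * w := by ring
  have e₃ : (Real.pi / 3 * 3 * w : ℂ) = 3 * (Real.pi / 3 * w) := by ring
  have e₅ : (Real.pi / 3 * 5 * w : ℂ) = 5 * (Real.pi / 3 * w) := by ring
  have e₆ : (Real.pi / 3 * 6 * w : ℂ) = 6 * (Real.pi / 3 * w) := by ring
  rw [e₁, e₃, e₅, e₆, mul_left_comm, key]
  have hq : ((a : ℂ) ^ 2 + a * b + b ^ 2) ≠ 0 := by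
    have : 0 < a ^ 2 + a * b + b ^ 2 := by positivity
    exact_mod_cast this.ne'
  have hab' : (a : ℂ) - b ≠ 0 := sub_ne_zero.2 (by exact_mod_cast hab)
  have hr : ((Real.sqrt 3 : ℝ) : ℂ) ≠ 0 := by
    exact_mod_cast (Real.sqrt_pos.2 (by norm_num : (0 : ℝ) < 3)).ne'
  have k₂ : (3 : ℂ) * (((a : ℂ) + b) / ((Real.sqrt 3 : ℝ) * (a ^ 3 - b ^ 3))) =
      ((a : ℂ) ^ 3 - b ^ 3)⁻¹ * ((Real.sqrt 3 : ℝ) * (a + b)) := by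
    rw [← ofReal_sqrt_three_sq]
    field_simp
  have k₁ : (1 : ℂ) / (3 * ((a : ℂ) ^ 2 + a * b + b ^ 2)) =
      ((a : ℂ) ^ 3 - b ^ 3)⁻¹ * (a - b) / 3 := by
    rw [show (a : ℂ) ^ 3 - b ^ 3 = (a - b) * (a ^ 2 + a * b + b ^ 2) by ring]
    field_simp
  rw [k₁, k₂]
  ring

lemma sin_mul_mellin_integrand {a b : ℝ} (ha : 0 < a) (hb : 0 < b) (hab : a ≠ b) {w : ℂ}
    (h₀ : -1 < w.re) (h₁ : w.re < 2) :
    Complex.sin ((Real.pi / 3 * 6 : ℝ) * w) * mellin (fun t : ℝ =>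
        ((t * (t - a) / ((t ^ 3 + a ^ 3) * (t ^ 2 - b * t + b ^ 2)) : ℝ) : ℂ)) (w + 1) =
      mellinNumerator a b w := by
  have hre (z : ℂ) : (z + 1).re = z.re + 1 := by simp
  have hopen : ∀ r : ℝ, IsOpen {z : ℂ | -1 < z.re ∧ z.re < r} := fun r =>
    (isOpen_lt continuous_const Complex.continuous_re).inter
      (isOpen_lt Complex.continuous_re continuous_const)
  have hconn : IsPreconnected {z : ℂ | -1 < z.re ∧ z.re < 2} :=
    ((convex_halfSpace_re_gt (-1)).inter (convex_halfSpace_re_lt 2)).isPreconnected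
  have hmellin : DifferentiableOn ℂ (fun z => mellin (fun t : ℝ =>
      ((t * (t - a) / ((t ^ 3 + a ^ 3) * (t ^ 2 - b * t + b ^ 2)) : ℝ) : ℂ)) (z + 1))
      {z : ℂ | -1 < z.re ∧ z.re < 2} := by
    intro z hz
    refine (DifferentiableAt.comp z (g := mellin _) (f := fun z => z + 1) ?_
      (by fun_prop)).differentiableWithinAt
    exact mellin_differentiableAt_of_isBigO_rpow
      ((continuousOn_integrand ha hb).locallyIntegrableOn measurableSet_Ioi)
      (integrand_isBigO_atTop ha hb) (by rw [hre]; linarith [hz.2])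
      (integrand_isBigO_zero ha hb) (by rw [hre]; linarith [hz.1])
  have hsin : Differentiable ℂ fun z : ℂ => Complex.sin ((Real.pi / 3 * 6 : ℝ) * z) := by fun_prop
  have hnum : Differentiable ℂ (mellinNumerator a b) := by
    unfold mellinNumerator
    fun_prop
  have key := ((hsin.differentiableOn.mul hmellin).analyticOnNhd
    (hopen 2)).eqOn_of_preconnected_of_eventuallyEq
    (hnum.differentiableOn.analyticOnNhd (hopen 2)) hconn (z₀ := -1 / 2)
    (by constructor <;> norm_num) (by
      filter_upwards [(hopen 0).mem_nhds (x := (-1 / 2 : ℂ)) (by constructor <;> norm_num)]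
        with z hz
      exact sin_mul_mellin_integrand_of_re_neg ha hb hab hz.1 hz.2)
  exact key ⟨h₀, h₁⟩

lemma hasDerivsAtZero_mellin_integrand {a b : ℝ} (ha : 0 < a) (hb : 0 < b) :
    HasDerivsAtZero (fun w => mellin (fun t : ℝ =>
        ((t * (t - a) / ((t ^ 3 + a ^ 3) * (t ^ 2 - b * t + b ^ 2)) : ℝ) : ℂ)) (w + 1))
      (fun k => ∫ t in Set.Ioi (0 : ℝ),
        t * (t - a) * Real.log t ^ k / ((t ^ 3 + a ^ 3) * (t ^ 2 - b * t + b ^ 2))) := by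
  have hloc := (continuousOn_integrand ha hb).locallyIntegrableOn (μ := volume) measurableSet_Ioi
  have hS : IsOpen {s : ℂ | 0 < s.re ∧ s.re < 3} :=
    (isOpen_lt continuous_const Complex.continuous_re).inter
      (isOpen_lt Complex.continuous_re continuous_const)
  constructor
  · refine AnalyticAt.fun_comp (g := mellin _) ?_ (by fun_prop)
    refine DifferentiableOn.analyticAt (s := {s : ℂ | 0 < s.re ∧ s.re < 3}) (fun z hz => ?_)
      (hS.mem_nhds (by constructor <;> norm_num))
    exact (mellin_differentiableAt_of_isBigO_rpow hloc (integrand_isBigO_atTop ha hb) hz.2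
      (integrand_isBigO_zero ha hb) hz.1).differentiableWithinAt
  · intro k
    rw [iteratedDeriv_comp_add_const]
    dsimp only
    rw [iteratedDeriv_mellin hloc (integrand_isBigO_atTop ha hb) (integrand_isBigO_zero ha hb) k
      (by constructor <;> norm_num), mellin, ← integral_complex_ofReal]
    refine setIntegral_congr_fun measurableSet_Ioi fun t _ => ?_
    simp only [zero_add, sub_self, Complex.cpow_zero, one_smul, Complex.real_smul]
    rw [← Complex.ofReal_mul]
    congr 1
    ring

lemma binomConv_sinCoeff_Ppoly (x : ℝ) (k : ℕ) :
    binomConv (sinCoeff 6) (fun k => (Ppoly k).eval x) (k + 1) =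
      3 * binomConv (fun j => cosCoeff 5 j + cosCoeff 1 j) (fun j => x ^ j) (k + 1) := by
  have h := binomConv_sinCoeff_recFam 6 x GP k
  rw [mul_eval_GP] at h
  exact h.trans (by ring)

lemma binomConv_sinCoeff_Qpoly (x : ℝ) (k : ℕ) :
    binomConv (sinCoeff 6) (fun k => (Qpoly k).eval x) (k + 1) =
      3 * binomConv (fun j => sinCoeff 5 j - sinCoeff 1 j) (fun j => x ^ j) (k + 1) := by
  have h := binomConv_sinCoeff_recFam 6 x GQ k
  rw [mul_eval_GQ] at h
  exact h.trans (by ring)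

lemma binomConv_sinCoeff_Zpoly (x : ℝ) (k : ℕ) :
    binomConv (sinCoeff 6) (fun k => (Zpoly k).eval x) (k + 1) =
      -12 * binomConv (cosCoeff 3) (fun j => x ^ j) (k + 1) := by
  have h := binomConv_sinCoeff_recFam 6 x GZ k
  rw [mul_eval_GZ] at h
  exact h.trans (by ring)

/-- Convolution of a combination of the recursive families with the derivatives of `sin (6δw)`. -/
lemma binomConv_sinCoeff_closedForm {δ : ℝ} (hδ : δ ≠ 0) (c₁ c₂ x y : ℝ) (k : ℕ) :
    binomConv (sinCoeff (δ * 6)) (fun k => δ ^ (k + 1) *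
        (c₁ * (-(Ppoly k).eval (x / δ) + 3 * (Ppoly k).eval (y / δ) + (Zpoly k).eval (x / δ))
          + c₂ * ((Qpoly k).eval (x / δ) - (Qpoly k).eval (y / δ)))) (k + 1) =
      δ * c₁ *
        (9 * binomConv (fun j => cosCoeff (δ * 5) j + cosCoeff (δ * 1) j) (fun j => y ^ j) (k + 1)
          - 3 * binomConv (fun j => cosCoeff (δ * 5) j + cosCoeff (δ * 1) j) (fun j => x ^ j)
            (k + 1)
          - 12 * binomConv (cosCoeff (δ * 3)) (fun j => x ^ j) (k + 1))
      + δ * (3 * c₂) *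
        (binomConv (fun j => sinCoeff (δ * 5) j - sinCoeff (δ * 1) j) (fun j => x ^ j) (k + 1)
          - binomConv (fun j => sinCoeff (δ * 5) j - sinCoeff (δ * 1) j) (fun j => y ^ j)
            (k + 1)) := by
  have hpow (z : ℝ) (j : ℕ) : z ^ j = δ ^ j * (z / δ) ^ j := by
    rw [← mul_pow, mul_div_cancel₀ _ hδ]
  have hcos (z : ℝ) := binomConv_scale (c := δ)
    (u := fun j => cosCoeff 5 j + cosCoeff 1 j) (v := fun j => (z / δ) ^ j)
    (u' := fun j => cosCoeff (δ * 5) j + cosCoeff (δ * 1) j) (v' := fun j => z ^ j)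
    (fun j => by rw [cosCoeff_mul, cosCoeff_mul]; ring) (hpow z) (k + 1)
  have hsin (z : ℝ) := binomConv_scale (c := δ)
    (u := fun j => sinCoeff 5 j - sinCoeff 1 j) (v := fun j => (z / δ) ^ j)
    (u' := fun j => sinCoeff (δ * 5) j - sinCoeff (δ * 1) j) (v' := fun j => z ^ j)
    (fun j => by rw [sinCoeff_mul, sinCoeff_mul]; ring) (hpow z) (k + 1)
  have hcos₃ := binomConv_scale (c := δ) (v' := fun j => x ^ j) (cosCoeff_mul δ 3) (hpow x) (k + 1)
  rw [hcos, hcos, hsin, hsin, hcos₃]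
  rw [binomConv_scale (c := δ) (sinCoeff_mul δ 6) (v := fun k =>
    δ * ((-c₁) * (Ppoly k).eval (x / δ) + 3 * c₁ * (Ppoly k).eval (y / δ)
      + c₁ * (Zpoly k).eval (x / δ) + c₂ * (Qpoly k).eval (x / δ)
      + (-c₂) * (Qpoly k).eval (y / δ))) (fun j => by ring)]
  simp only [binomConv_const_mul, binomConv_add, binomConv_sinCoeff_Ppoly,
    binomConv_sinCoeff_Qpoly, binomConv_sinCoeff_Zpoly]
  ring

lemma hasDerivsAtZero_mellinNumerator (a b : ℝ) :
    HasDerivsAtZero (mellinNumerator a b) fun n =>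
      Real.pi / 3 * (1 / (3 * (a ^ 2 + a * b + b ^ 2))) *
        (9 * binomConv (fun j => cosCoeff (Real.pi / 3 * 5) j + cosCoeff (Real.pi / 3 * 1) j)
              (fun j => Real.log b ^ j) n
          - 3 * binomConv (fun j => cosCoeff (Real.pi / 3 * 5) j + cosCoeff (Real.pi / 3 * 1) j)
              (fun j => Real.log a ^ j) n
          - 12 * binomConv (cosCoeff (Real.pi / 3 * 3)) (fun j => Real.log a ^ j) n)
      + Real.pi / 3 * (3 * ((a + b) / (Real.sqrt 3 * (a ^ 3 - b ^ 3)))) *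
        (binomConv (fun j => sinCoeff (Real.pi / 3 * 5) j - sinCoeff (Real.pi / 3 * 1) j)
              (fun j => Real.log a ^ j) n
          - binomConv (fun j => sinCoeff (Real.pi / 3 * 5) j - sinCoeff (Real.pi / 3 * 1) j)
              (fun j => Real.log b ^ j) n) :=
  have hcos := (HasDerivsAtZero.cos (Real.pi / 3 * 5)).add (.cos (Real.pi / 3 * 1))
  have hsin := (HasDerivsAtZero.sin (Real.pi / 3 * 5)).sub (.sin (Real.pi / 3 * 1))
  (((((hcos.mul (.exp _)).const_mul _).sub ((hcos.mul (.exp _)).const_mul _)).sub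
    (((HasDerivsAtZero.cos _).mul (.exp _)).const_mul _)).const_mul _).add
    (((hsin.mul (.exp _)).sub (hsin.mul (.exp _))).const_mul _)

/-- The integral `g₂(k) = ∫₀^∞ t(t−a) logᵏt /((t³+a³)(t²−bt+b²)) dt` in terms of the
recursive polynomials `P_k`, `Q_k`, `Z_k`, with `δ = π/3`. -/
theorem g2_eval (a b : ℝ) (ha : 0 < a) (hb : 0 < b) (hab : a ≠ b) (k : ℕ) :
    ∫ t in Set.Ioi (0 : ℝ),
        t * (t - a) * Real.log t ^ k / ((t ^ 3 + a ^ 3) * (t ^ 2 - b * t + b ^ 2)) =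
      (Real.pi / 3) ^ (k + 1) / (3 * (a ^ 2 + a * b + b ^ 2)) *
          (-(Ppoly k).eval (Real.log a / (Real.pi / 3))
            + 3 * (Ppoly k).eval (Real.log b / (Real.pi / 3))
            + (Zpoly k).eval (Real.log a / (Real.pi / 3)))
        + (Real.pi / 3) ^ (k + 1) * (a + b) / (Real.sqrt 3 * (a ^ 3 - b ^ 3)) *
          ((Qpoly k).eval (Real.log a / (Real.pi / 3))
            - (Qpoly k).eval (Real.log b / (Real.pi / 3))) := by
  have hδ : Real.pi / 3 ≠ 0 := by positivity
  have hseq := ((HasDerivsAtZero.sin (Real.pi / 3 * 6)).mul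
    (hasDerivsAtZero_mellin_integrand ha hb)).unique (hasDerivsAtZero_mellinNumerator a b) (by
      filter_upwards [Complex.continuous_re.continuousAt.eventually
        (Ioo_mem_nhds (by norm_num : (-1 : ℝ) < (0 : ℂ).re) (by norm_num : (0 : ℂ).re < 2))]
        with w hw
      exact sin_mul_mellin_integrand ha hb hab hw.1 hw.2)
  have key := eq_of_binomConv_eq (u := sinCoeff (Real.pi / 3 * 6)) (by simp [sinCoeff])
    (by simp [sinCoeff, Real.pi_ne_zero])
    (fun j => (hseq (j + 1)).trans (binomConv_sinCoeff_closedForm hδ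
      (1 / (3 * (a ^ 2 + a * b + b ^ 2))) ((a + b) / (Real.sqrt 3 * (a ^ 3 - b ^ 3)))
      (Real.log a) (Real.log b) j).symm) k
  refine key.trans ?_
  ring
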